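/- Let E be a finite set with |E| = m and f : 2^E → ℝ≥0 a monotone submodular function with f(S) = 0 if and only if S = ∅. Let κ = max_{x ∈ E} f({x}) and ℓ = f(E)/κ. Suppose ∅ = Π_0 ⊊ Π_1 ⊊ ⋯ ⊊ Π_s = E is a chain such that for each 1 ≤ i ≤ s, both Π_{i−1} and Π_i minimize X ↦ f(X) − λ_i|X| over all X ⊆ E, where λ_i = (f(Π_i) − f(Π_{i−1})) / (|Π_i| − |Π_{i−1}|). Let σ : E → {1,…,m} be any bijection with E_{|Π_i|,σ} = Π_i for all 1 ≤ i ≤ s. Then for every bijection π : E → {1,…,m}: ∑_{k=1}^m f(E_{k,σ}) ≤ (2 − (1 + ℓ)/(1 + m)) · ∑_{k=1}^m f(E_{k,π}). -/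

import Mathlib

/-- The prefix set `E_{i,σ} = {e : σ(e) ≤ i}`, where the bijection `σ : α ≃ Fin m`
is interpreted as a labeling by `{1,…,m}` via `e ↦ (σ e) + 1`. -/
def prefixSet {α : Type*} [Fintype α] [DecidableEq α] {m : ℕ} (σ : α ≃ Fin m) (i : ℕ) :
    Finset α :=
  Finset.univ.filter fun e => (σ e : ℕ) < i

section PrefixSet

variable {α : Type*} [Fintype α] [DecidableEq α] {m : ℕ}

theorem card_prefixSet (σ : α ≃ Fin m) {i : ℕ} (hi : i ≤ m) : (prefixSet σ i).card = i := by
  have h : (prefixSet σ i).map σ.toEmbedding = Finset.univ.filter fun j : Fin m => (j : ℕ) < i := by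
    ext j
    simp [prefixSet]
  rw [← Finset.card_map σ.toEmbedding, h, Fin.card_filter_val_lt, min_eq_right hi]

theorem prefixSet_mono (σ : α ≃ Fin m) {i j : ℕ} (hij : i ≤ j) :
    prefixSet σ i ⊆ prefixSet σ j := by
  intro e he
  simp only [prefixSet, Finset.mem_filter, Finset.mem_univ, true_and] at he ⊢
  omega

theorem prefixSet_succ_subset (σ : α ≃ Fin m) {i : ℕ} (hi : i < m) :
    prefixSet σ (i + 1) ⊆ prefixSet σ i ∪ {σ.symm ⟨i, hi⟩} := by
  intro e he
  simp only [prefixSet, Finset.mem_filter, Finset.mem_univ, true_and, Finset.mem_union,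
    Finset.mem_singleton, Equiv.eq_symm_apply, Fin.ext_iff] at he ⊢
  omega

/-- A monotone submodular function grows by at most the steepness per added element. -/
theorem prefixSet_add_le {f : Finset α → ℝ} {κ : ℝ} (hnn : ∀ S, 0 ≤ f S)
    (hmono : ∀ S T : Finset α, S ⊆ T → f S ≤ f T)
    (hsub : ∀ S T : Finset α, f (S ∪ T) + f (S ∩ T) ≤ f S + f T)
    (hκ : ∀ x, f {x} ≤ κ) (σ : α ≃ Fin m) (p n : ℕ) (h : p + n ≤ m) :
    f (prefixSet σ (p + n)) ≤ f (prefixSet σ p) + n * κ := by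
  induction n with
  | zero => simp
  | succ n ih =>
    have hlt : p + n < m := by omega
    have h1 := hmono _ _ (prefixSet_succ_subset σ hlt)
    have h2 := hsub (prefixSet σ (p + n)) {σ.symm ⟨p + n, hlt⟩}
    have h3 := hnn (prefixSet σ (p + n) ∩ {σ.symm ⟨p + n, hlt⟩})
    have h4 := hκ (σ.symm ⟨p + n, hlt⟩)
    have h5 := ih (by omega)
    rw [← add_assoc]
    push_cast
    linarith

end PrefixSet

theorem sum_range_cast_succ (n : ℕ) :
    ∑ k ∈ Finset.range n, ((k : ℝ) + 1) = n * (n + 1) / 2 := by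
  induction n with
  | zero => simp
  | succ n ih =>
    rw [Finset.sum_range_succ, ih]
    push_cast
    ring

theorem sum_range_min_le {q : ℝ} (hq0 : 0 ≤ q) (n : ℕ) (hq : q ≤ n) :
    ∑ k ∈ Finset.range n, min q ((k : ℝ) + 1) ≤ q * (2 * n + 1 - q) / 2 := by
  induction n with
  | zero =>
    simp only [Nat.cast_zero] at hq
    simp only [Finset.range_zero, Finset.sum_empty, Nat.cast_zero]
    nlinarith
  | succ n ih =>
    rw [Finset.sum_range_succ]
    push_cast at hq ⊢
    have h1 := min_le_left q ((n : ℝ) + 1)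
    rcases le_or_gt q n with h | h
    · have := ih h
      linarith
    · have h2 : ∑ k ∈ Finset.range n, min q ((k : ℝ) + 1) ≤ n * (n + 1) / 2 := by
        rw [← sum_range_cast_succ]
        exact Finset.sum_le_sum fun k _ => min_le_right _ _
      nlinarith [mul_nonneg (sub_nonneg.2 h.le) (sub_nonneg.2 hq)]

theorem stmt_11 {α : Type*} [Fintype α] [DecidableEq α] {m s : ℕ}
    (hm : Fintype.card α = m) (f : Finset α → ℝ)
    (hnn : ∀ S : Finset α, 0 ≤ f S)
    (hmono : ∀ S T : Finset α, S ⊆ T → f S ≤ f T)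
    (hsub : ∀ S T : Finset α, f (S ∪ T) + f (S ∩ T) ≤ f S + f T)
    (hzero : ∀ A : Finset α, f A = 0 ↔ A = ∅)
    -- the steepness `κ = max_{x ∈ E} f({x})` and the linearity `ℓ = f(E)/κ`
    (κ ℓ : ℝ) (hκub : ∀ x : α, f {x} ≤ κ) (hκmem : ∃ x : α, f {x} = κ)
    (hℓ : ℓ = f Finset.univ / κ)
    -- the principal-partition chain `∅ = Π_0 ⊊ ⋯ ⊊ Π_s = E` with critical values `λ_i`
    (hs : 1 ≤ s) (P : ℕ → Finset α)
    (hP0 : P 0 = ∅) (hPs : P s = Finset.univ)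
    (hchain : ∀ i < s, P i ⊂ P (i + 1))
    (lam : ℕ → ℝ)
    (hlam : ∀ i < s,
      lam (i + 1) = (f (P (i + 1)) - f (P i)) / (((P (i + 1)).card : ℝ) - ((P i).card : ℝ)))
    (hmin : ∀ i < s, ∀ X : Finset α,
      (f (P i) - lam (i + 1) * ((P i).card : ℝ) ≤ f X - lam (i + 1) * (X.card : ℝ)) ∧
      (f (P (i + 1)) - lam (i + 1) * ((P (i + 1)).card : ℝ) ≤
        f X - lam (i + 1) * (X.card : ℝ)))
    -- `σ` is a linear extension of the chain
    (σ : α ≃ Fin m)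
    (hlin : ∀ i : ℕ, 1 ≤ i → i ≤ s → prefixSet σ ((P i).card) = P i) :
    ∀ π : α ≃ Fin m,
      ∑ k ∈ Finset.range m, f (prefixSet σ (k + 1)) ≤
        (2 - (1 + ℓ) / (1 + (m : ℝ))) * ∑ k ∈ Finset.range m, f (prefixSet π (k + 1)) := by
  intro π
  have hκ : 0 < κ := by
    obtain ⟨x, rfl⟩ := hκmem
    exact lt_of_le_of_ne (hnn _) fun h => Finset.singleton_ne_empty x ((hzero _).1 h.symm)
  have hpre : ∀ i ≤ s, prefixSet σ (P i).card = P i := by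
    intro i hi
    rcases Nat.eq_zero_or_pos i with rfl | h
    · simp [hP0, prefixSet]
    · exact hlin i h hi
  have key : ∀ i ≤ s, ∃ x D : ℝ, f (P i) = κ * x ∧ 0 ≤ x ∧ x ≤ (P i).card ∧
      ∑ k ∈ Finset.range (P i).card, f (prefixSet σ (k + 1)) ≤
        ∑ k ∈ Finset.range (P i).card, f (prefixSet π (k + 1)) + κ * D / 2 ∧
      κ * (x + x ^ 2 + D) ≤ 2 * ∑ k ∈ Finset.range (P i).card, f (prefixSet π (k + 1)) ∧
      D ≤ x * ((P i).card - x) := by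
    intro i
    induction i with
    | zero =>
      intro _
      refine ⟨0, 0, ?_⟩
      simp [hP0, (hzero ∅).2 rfl]
    | succ i ih =>
      intro hi
      obtain ⟨x, D, hx, hx0, hxp, hST, hT, hD⟩ := ih (by omega)
      have hlt := Finset.card_lt_card (hchain i hi)
      have hle : (P (i + 1)).card ≤ m := hm ▸ Finset.card_le_univ _
      have hpi := hpre i (by omega)
      have hpi' := hpre (i + 1) hi
      have hlam' := hlam i hi
      have hmin' := fun X => (hmin i hi X).1
      generalize (P (i + 1)).card = p' at *
      generalize (P i).card = p at *
      obtain ⟨n, rfl⟩ := Nat.exists_eq_add_of_le hlt.le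
      have hn : (0 : ℝ) < n := by
        have : 0 < n := by omega
        exact_mod_cast this
      have hPP := hmono _ _ (hchain i hi).subset
      obtain ⟨q, hq⟩ : ∃ q, f (P (i + 1)) = κ * (x + q) :=
        ⟨f (P (i + 1)) / κ - x, by field_simp; ring⟩
      have hq0 : 0 ≤ q := by
        rw [hq, hx] at hPP
        linarith [le_of_mul_le_mul_left hPP hκ]
      have hqn : q ≤ n := by
        have h := prefixSet_add_le hnn hmono hsub hκub σ p n hle
        rw [hpi, hpi', hq, hx] at h
        have : κ * (x + q) ≤ κ * (x + n) := by linarith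
        linarith [le_of_mul_le_mul_left this hκ]
      have hlamn : lam (i + 1) * n = κ * q := by
        rw [hlam', hq, hx]
        push_cast
        rw [add_sub_cancel_left, div_mul_cancel₀ _ hn.ne']
        ring
      have hσ : ∑ k ∈ Finset.range n, f (prefixSet σ (p + k + 1)) ≤
          n * (κ * x) + κ * (q * (2 * n + 1 - q) / 2) := by
        calc _ ≤ ∑ k ∈ Finset.range n, (κ * x + κ * min q ((k : ℝ) + 1)) := by
              refine Finset.sum_le_sum fun k hk => ?_
              have hk := Finset.mem_range.1 hk
              have h1 := prefixSet_add_le hnn hmono hsub hκub σ p (k + 1) (by omega)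
              have h2 := hmono _ _ (prefixSet_mono σ (show p + k + 1 ≤ p + n by omega))
              rw [hpi, hx, ← add_assoc] at h1
              rw [hpi', hq] at h2
              push_cast at h1
              rcases min_choice q ((k : ℝ) + 1) with h | h <;> rw [h] <;> linarith
          _ ≤ _ := by
              rw [Finset.sum_add_distrib, Finset.sum_const, Finset.card_range, nsmul_eq_mul,
                ← Finset.mul_sum]
              gcongr
              exact sum_range_min_le hq0 n hqn
      have hπ : n * (κ * x) + κ * q * (n + 1) / 2 ≤
          ∑ k ∈ Finset.range n, f (prefixSet π (p + k + 1)) := by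
        calc _ = ∑ k ∈ Finset.range n, (κ * x + lam (i + 1) * ((k : ℝ) + 1)) := by
              rw [Finset.sum_add_distrib, Finset.sum_const, Finset.card_range, nsmul_eq_mul,
                ← Finset.mul_sum, sum_range_cast_succ, ← hlamn]
              ring
          _ ≤ _ := by
              refine Finset.sum_le_sum fun k hk => ?_
              have hk := Finset.mem_range.1 hk
              have h := hmin' (prefixSet π (p + k + 1))
              rw [card_prefixSet π (by omega), hx] at h
              push_cast at h
              linarith
      refine ⟨x + q, D + q * (n - q), hq, by positivity, ?_, ?_, ?_, ?_⟩
      · push_cast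
        linarith
      · rw [Finset.sum_range_add, Finset.sum_range_add]
        linarith
      · rw [Finset.sum_range_add]
        have : 0 ≤ κ * (x * (n - q)) := by
          have := sub_nonneg.2 hqn
          positivity
        linarith
      · push_cast
        have h1 := mul_nonneg hq0 (sub_nonneg.2 hxp)
        have h2 := mul_nonneg hx0 (sub_nonneg.2 hqn)
        linarith
  obtain ⟨x, D, hx, hx0, hxm, hST, hT, hD⟩ := key s le_rfl
  rw [hPs] at hx hxm hST hT hD
  rw [Finset.card_univ, hm] at hxm hST hT hD
  have hℓx : ℓ = x := by rw [hℓ, hx, mul_div_cancel_left₀ _ hκ.ne']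
  subst hℓx
  set S := ∑ k ∈ Finset.range m, f (prefixSet σ (k + 1))
  set T := ∑ k ∈ Finset.range m, f (prefixSet π (k + 1))
  have hm1 : (0 : ℝ) < 1 + m := by positivity
  have h1 : (2 - (1 + ℓ) / (1 + (m : ℝ))) * T = (2 * m + 1 - ℓ) * T / (1 + m) := by
    field_simp
    ring
  rw [h1, le_div_iff₀ hm1]
  have h2 := mul_le_mul_of_nonneg_left hT (sub_nonneg.2 hxm)
  have h3 := mul_le_mul_of_nonneg_left hD (by positivity : 0 ≤ κ * (1 + ℓ))
  have h4 := mul_le_mul_of_nonneg_right hST hm1.le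
  linarith
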